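/- Fix q ∈ (0,1] and ε ∈ (0, 1/2), and define J : (0,1) → ℝ by J(p) = (1−ε)(−log_q p) + ε(−log_q(1−p)). Then J is strictly convex on (0,1), J' has a unique zero p* ∈ (0,1), p* is the unique global minimizer of J, and it satisfies (1 − p*)/p* = (ε/(1−ε))^{1/q}; explicitly, p* = (1−ε)^{1/q} / ((1−ε)^{1/q} + ε^{1/q}), so the noise contamination at equilibrium is p̃* = 1 − p* = ε^{1/q} / (ε^{1/q} + (1−ε)^{1/q}). -/

import Mathlib

/-- The negated Tsallis q-logarithm `−log_q(u)`. -/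
noncomputable def negLogq (q u : ℝ) : ℝ :=
  if q = 1 then -Real.log u else -((u ^ (1 - q) - 1) / (1 - q))

/-- The negated `q`-logarithm has derivative `-u ^ (-q)`. -/
lemma hasDerivAt_negLogq (q : ℝ) {u : ℝ} (hu : 0 < u) :
    HasDerivAt (negLogq q) (-u ^ (-q)) u := by
  unfold negLogq
  split_ifs with hq
  · subst hq
    rw [Real.rpow_neg_one]
    exact (Real.hasDerivAt_log hu.ne').neg
  · have hq' : 1 - q ≠ 0 := sub_ne_zero.mpr (Ne.symm hq)
    convert! (((Real.hasDerivAt_rpow_const (p := 1 - q) (Or.inl hu.ne')).sub_const 1).div_const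
      (1 - q)).neg using 2
    rw [mul_div_cancel_left₀ _ hq']
    congr 1
    ring

/-- The derivative of the expected loss `(1 - ε) * negLogq q p + ε * negLogq q (1 - p)`. -/
lemma hasDerivAt_expected_negLogq (q ε : ℝ) {p : ℝ} (hp : p ∈ Set.Ioo (0 : ℝ) 1) :
    HasDerivAt (fun p => (1 - ε) * negLogq q p + ε * negLogq q (1 - p))
      (ε * (1 - p) ^ (-q) - (1 - ε) * p ^ (-q)) p := by
  have h₂ := (hasDerivAt_negLogq q (sub_pos.mpr hp.2)).comp_const_sub 1 p
  convert! ((hasDerivAt_negLogq q hp.1).const_mul (1 - ε)).add (h₂.const_mul ε) using 1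
  ring

lemma strictMonoOn_expected_negLogq_deriv {q ε : ℝ} (hq : 0 < q) (hε0 : 0 < ε) (hε1 : ε < 1) :
    StrictMonoOn (fun p : ℝ => ε * (1 - p) ^ (-q) - (1 - ε) * p ^ (-q)) (Set.Ioo 0 1) := by
  intro x hx y hy hxy
  have h₁ : y ^ (-q) < x ^ (-q) := Real.rpow_lt_rpow_of_neg hx.1 hxy (neg_neg_of_pos hq)
  have h₂ : (1 - x) ^ (-q) < (1 - y) ^ (-q) :=
    Real.rpow_lt_rpow_of_neg (sub_pos.mpr hy.2) (by linarith) (neg_neg_of_pos hq)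
  have h₃ := mul_lt_mul_of_pos_left h₁ (sub_pos.mpr hε1)
  have h₄ := mul_lt_mul_of_pos_left h₂ hε0
  dsimp only
  linarith

lemma mul_rpow_one_div_div_rpow_neg {q c s : ℝ} (hq : q ≠ 0) (hc : 0 < c) (hs : 0 < s) :
    c * (c ^ (1 / q) / s) ^ (-q) = s ^ q := by
  rw [Real.div_rpow (by positivity) hs.le, ← Real.rpow_mul hc.le, Real.rpow_neg hs.le,
    show 1 / q * -q = -1 by field_simp, Real.rpow_neg_one]
  field_simp

/-- **noise equilibrium / escort asymptote.** Fix `q ∈ (0,1]` and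
`ε ∈ (0, 1/2)`, and let `J(p) = (1−ε)(−log_q p) + ε(−log_q(1−p))` on `(0,1)`.  Then
`J` is strictly convex on `(0,1)`, its derivative has a unique zero
`p* = (1−ε)^{1/q} / ((1−ε)^{1/q} + ε^{1/q})` in `(0,1)` which is the unique global
minimizer, and it satisfies `(1 − p*)/p* = (ε/(1−ε))^{1/q}`; the equilibrium noise
contamination is `1 − p* = ε^{1/q} / (ε^{1/q} + (1−ε)^{1/q})`. -/
theorem noise_equilibrium_escort
    {q ε : ℝ} (hq0 : 0 < q) (hq1 : q ≤ 1) (hε0 : 0 < ε) (hε1 : ε < 1 / 2) :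
    let J : ℝ → ℝ := fun p => (1 - ε) * negLogq q p + ε * negLogq q (1 - p)
    let pstar : ℝ := (1 - ε) ^ (1 / q) / ((1 - ε) ^ (1 / q) + ε ^ (1 / q))
    StrictConvexOn ℝ (Set.Ioo 0 1) J ∧
    pstar ∈ Set.Ioo (0 : ℝ) 1 ∧
    deriv J pstar = 0 ∧
    (∀ p ∈ Set.Ioo (0 : ℝ) 1, deriv J p = 0 → p = pstar) ∧
    (∀ p ∈ Set.Ioo (0 : ℝ) 1, p ≠ pstar → J pstar < J p) ∧
    (1 - pstar) / pstar = (ε / (1 - ε)) ^ (1 / q) ∧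
    1 - pstar = ε ^ (1 / q) / (ε ^ (1 / q) + (1 - ε) ^ (1 / q)) := by
  intro J pstar
  have hε' : 0 < 1 - ε := by linarith
  have ha : 0 < (1 - ε) ^ (1 / q) := Real.rpow_pos_of_pos hε' _
  have hb : 0 < ε ^ (1 / q) := Real.rpow_pos_of_pos hε0 _
  have hs : 0 < (1 - ε) ^ (1 / q) + ε ^ (1 / q) := add_pos ha hb
  have hcompl : 1 - pstar = ε ^ (1 / q) / ((1 - ε) ^ (1 / q) + ε ^ (1 / q)) := by
    simp only [pstar]
    field_simp
    ring
  have hmem : pstar ∈ Set.Ioo (0 : ℝ) 1 := by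
    refine ⟨div_pos ha hs, sub_pos.mp ?_⟩
    rw [hcompl]
    exact div_pos hb hs
  have hderiv : ∀ p ∈ Set.Ioo (0 : ℝ) 1,
      HasDerivAt J (ε * (1 - p) ^ (-q) - (1 - ε) * p ^ (-q)) p :=
    fun p hp => hasDerivAt_expected_negLogq q ε hp
  have hmono : StrictMonoOn (deriv J) (Set.Ioo 0 1) :=
    (strictMonoOn_expected_negLogq_deriv hq0 hε0 (by linarith)).congr
      fun p hp => (hderiv p hp).deriv.symm
  have hconv : StrictConvexOn ℝ (Set.Ioo 0 1) J :=
    StrictMonoOn.strictConvexOn_of_deriv (convex_Ioo 0 1)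
      (fun p hp => (hderiv p hp).continuousAt.continuousWithinAt) (by rwa [interior_Ioo])
  have hzero : deriv J pstar = 0 := by
    rw [(hderiv pstar hmem).deriv, hcompl, mul_rpow_one_div_div_rpow_neg hq0.ne' hε0 hs,
      mul_rpow_one_div_div_rpow_neg hq0.ne' hε' hs, sub_self]
  have hcrit : HasDerivAt J 0 pstar := hzero ▸ (hderiv pstar hmem).differentiableAt.hasDerivAt
  refine ⟨hconv, hmem, hzero, fun p hp h => hmono.injOn hp hmem (h.trans hzero.symm), ?_, ?_, ?_⟩
  · intro p hp hne
    rcases hne.lt_or_gt with h | h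
    · have := hconv.slope_lt_of_hasDerivAt hp hmem h hcrit
      rw [slope_def_field, div_neg_iff] at this
      rcases this with h' | h' <;> linarith
    · have := hconv.lt_slope_of_hasDerivAt hmem hp h hcrit
      rw [slope_def_field, div_pos_iff] at this
      rcases this with h' | h' <;> linarith
  · rw [hcompl, Real.div_rpow hε0.le hε'.le]
    exact div_div_div_cancel_right₀ hs.ne' _ _
  · rw [hcompl, add_comm]
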